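/- The fiber map τ^θ, defined by τ^θ f(ω) := |sin θ|^{−n/2} ((C_θ f)^(ω csc θ + k))_{k∈ℤⁿ} for ω ∈ I = [0, |sin θ|]ⁿ, is a well-defined unitary operator from L²(ℝⁿ) onto L²(I, ℓ²(ℤⁿ)); in particular, for every f ∈ L²(ℝⁿ), ‖f‖²_{L²(ℝⁿ)} = |sin θ|^{−n} ∫_I Σ_{k∈ℤⁿ} |(C_θ f)^(ω csc θ + k)|² dω. -/

import Mathlib

noncomputable section

open MeasureTheory Complex
open scoped InnerProductSpace ENNReal

abbrev Rn (n : ℕ) : Type := EuclideanSpace ℝ (Fin n)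

variable {n : ℕ}

/-- Chirp modulation `C_θ f (t) = e^{πi (t·t) cot θ} f(t)`. -/
def chirp (θ : ℝ) (f : Rn n → ℂ) : Rn n → ℂ :=
  fun t => Complex.exp (((Real.pi * ⟪t, t⟫_ℝ * Real.cot θ : ℝ) : ℂ) * Complex.I) * f t

lemma memℒp_chirp (θ : ℝ) (f : Rn n → ℂ) (hf : MemLp f 2 (volume : Measure (Rn n))) :
    MemLp (chirp θ f) 2 (volume : Measure (Rn n)) := by
  have hcont : Continuous fun t : Rn n =>
      Complex.exp (((Real.pi * ⟪t, t⟫_ℝ * Real.cot θ : ℝ) : ℂ) * Complex.I) :=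
    Complex.continuous_exp.comp
      ((Complex.continuous_ofReal.comp
        ((continuous_const.mul ((continuous_id (X := Rn n)).inner continuous_id)).mul
          continuous_const)).mul continuous_const)
  refine ⟨hcont.aestronglyMeasurable.mul hf.1, ?_⟩
  have heq : eLpNorm (chirp θ f) 2 (volume : Measure (Rn n)) = eLpNorm f 2 volume := by
    refine eLpNorm_congr_norm_ae (Filter.Eventually.of_forall fun t => ?_)
    show ‖Complex.exp (((Real.pi * ⟪t, t⟫_ℝ * Real.cot θ : ℝ) : ℂ) * Complex.I) * f t‖ = ‖f t‖
    rw [norm_mul, Complex.norm_exp_ofReal_mul_I, one_mul]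
  exact heq ▸ hf.2

/-- Chirp modulation as a map on `L²(ℝⁿ)`. -/
def chirpLp (θ : ℝ) (f : Lp ℂ 2 (volume : Measure (Rn n))) :
    Lp ℂ 2 (volume : Measure (Rn n)) :=
  (memℒp_chirp θ f (Lp.memLp f)).toLp (chirp θ f)

/-- `𝓕` is the Fourier–Plancherel transform: the unitary operator on `L²(ℝⁿ)` agreeing with
the Fourier integral `ĥ(ξ) = ∫ h(t) e^{-2πi t·ξ} dt` on `L¹ ∩ L²`. -/
def IsPlancherel
    (𝓕 : Lp ℂ 2 (volume : Measure (Rn n)) ≃ₗᵢ[ℂ] Lp ℂ 2 (volume : Measure (Rn n))) : Prop :=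
  ∀ (f : Rn n → ℂ) (hf : MemLp f 2 (volume : Measure (Rn n))),
    Integrable f (volume : Measure (Rn n)) →
      (𝓕 (hf.toLp f) : Rn n → ℂ) =ᵐ[(volume : Measure (Rn n))]
        fun ξ => ∫ t, f t * Complex.exp (((-2 * Real.pi * ⟪t, ξ⟫_ℝ : ℝ) : ℂ) * Complex.I)

/-- The embedding `ℤⁿ ↪ ℝⁿ`. -/
def zcast {n : ℕ} (k : Fin n → ℤ) : Rn n :=
  (WithLp.equiv 2 (Fin n → ℝ)).symm fun i => (k i : ℝ)

/-- The box `I = [0, |sin θ|]ⁿ`. -/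
def Iθ (n : ℕ) (θ : ℝ) : Set (Rn n) := {ω | ∀ i, ω i ∈ Set.Icc (0 : ℝ) |Real.sin θ|}

/-- The fiber `τ^θ f (ω) = |sin θ|^{-n/2} ((C_θ f)^(ω csc θ + k))_{k ∈ ℤⁿ}`. -/
def fiber (𝓕 : Lp ℂ 2 (volume : Measure (Rn n)) ≃ₗᵢ[ℂ] Lp ℂ 2 (volume : Measure (Rn n)))
    (θ : ℝ) (f : Lp ℂ 2 (volume : Measure (Rn n))) (ω : Rn n) (k : Fin n → ℤ) : ℂ :=
  ((|Real.sin θ| ^ (-(n : ℝ) / 2) : ℝ) : ℂ) *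
    (𝓕 (chirpLp θ f) : Rn n → ℂ) ((Real.sin θ)⁻¹ • ω + zcast k)

lemma eLpNorm_two_sq_eq_lintegral {X E : Type*} [MeasurableSpace X] [NormedAddCommGroup E]
    (μ : Measure X) (f : X → E) : eLpNorm f 2 μ ^ 2 = ∫⁻ x, ‖f x‖ₑ ^ 2 ∂μ := by
  simpa using eLpNorm_nnreal_pow_eq_lintegral (μ := μ) (f := f) (p := 2) two_ne_zero

lemma memLp_two_of_lintegral_ne_top {X E : Type*} [MeasurableSpace X] [NormedAddCommGroup E]
    {μ : Measure X} {f : X → E} (hf : AEStronglyMeasurable f μ)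
    (h : ∫⁻ x, ‖f x‖ₑ ^ 2 ∂μ ≠ ∞) : MemLp f 2 μ := by
  refine ⟨hf, lt_top_iff_ne_top.2 fun htop => h ?_⟩
  rw [← eLpNorm_two_sq_eq_lintegral, htop]
  simp

lemma lintegral_enorm_sq_ne_top_of_memLp {X E : Type*} [MeasurableSpace X]
    [NormedAddCommGroup E] {μ : Measure X} {f : X → E} (hf : MemLp f 2 μ) :
    ∫⁻ x, ‖f x‖ₑ ^ 2 ∂μ ≠ ∞ := by
  rw [← eLpNorm_two_sq_eq_lintegral]
  exact ENNReal.pow_ne_top hf.2.ne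

lemma norm_Lp_two_eq_of_lintegral_eq {X Y E F : Type*} [MeasurableSpace X] [MeasurableSpace Y]
    [NormedAddCommGroup E] [NormedAddCommGroup F] {μ : Measure X} {ν : Measure Y}
    (f : Lp E 2 μ) (g : Lp F 2 ν)
    (h : ∫⁻ x, ‖f x‖ₑ ^ 2 ∂μ = ∫⁻ y, ‖g y‖ₑ ^ 2 ∂ν) : ‖f‖ = ‖g‖ := by
  rw [← eLpNorm_two_sq_eq_lintegral, ← eLpNorm_two_sq_eq_lintegral] at h
  rw [Lp.norm_def, Lp.norm_def, (ENNReal.pow_right_strictMono two_ne_zero).injective h]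

section lpTwo

variable {K : Type*}

lemma memℓp_two_of_tsum_ne_top {v : K → ℂ} (h : ∑' k, ‖v k‖ₑ ^ 2 ≠ ∞) : Memℓp v 2 := by
  refine memℓp_gen ?_
  have := ENNReal.summable_toReal h
  simpa using this

lemma lp_two_enorm_sq (v : lp (fun _ : K => ℂ) 2) : ‖v‖ₑ ^ 2 = ∑' k, ‖v k‖ₑ ^ 2 := by
  have hs := lp.hasSum_norm (p := 2) (by norm_num) v
  simp only [ENNReal.toReal_ofNat, Real.rpow_ofNat] at hs
  have := ENNReal.ofReal_tsum_of_nonneg (fun k => sq_nonneg ‖v k‖) hs.summable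
  rw [hs.tsum_eq] at this
  simpa [ENNReal.ofReal_pow, ofReal_norm] using this

open Classical in
/-- The element of `ℓ²` with the given coordinates, or `0` if they are not square-summable. -/
def toLpTwo (v : K → ℂ) : lp (fun _ : K => ℂ) 2 := if h : Memℓp v 2 then ⟨v, h⟩ else 0

lemma toLpTwo_apply {v : K → ℂ} (h : Memℓp v 2) (k : K) : toLpTwo v k = v k := by
  simp [toLpTwo, h]

lemma aestronglyMeasurable_toLpTwo [Countable K] {Y : Type*} [MeasurableSpace Y] {ν : Measure Y}
    {F : Y → K → ℂ} (hF : ∀ k, AEStronglyMeasurable (fun y => F y k) ν)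
    (hm : ∀ᵐ y ∂ν, Memℓp (F y) 2) : AEStronglyMeasurable (fun y => toLpTwo (F y)) ν := by
  classical
  refine aestronglyMeasurable_of_tendsto_ae (Filter.atTop : Filter (Finset K))
    (f := fun s y => ∑ k ∈ s, lp.single (E := fun _ : K => ℂ) 2 k (F y k)) (fun s => ?_) ?_
  · refine Finset.aestronglyMeasurable_fun_sum s fun k _ => ?_
    exact (lp.isometry_single (E := fun _ : K => ℂ) (p := 2) k).continuous.comp_aestronglyMeasurable
      (hF k)
  · filter_upwards [hm] with y hy
    have := lp.hasSum_single ENNReal.ofNat_ne_top (toLpTwo (F y))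
    simpa [HasSum, toLpTwo_apply hy] using this

end lpTwo

section Fibering

variable {K X Y : Type*} [MeasurableSpace X] [MeasurableSpace Y]
  {μ : Measure X} {ν : Measure Y} {φ : K → Y → X} {C : ℝ≥0∞}

lemma quasiMeasurePreserving_of_lintegral_tsum (hφ : ∀ k, Measurable (φ k))
    (hC : ∀ F : X → ℝ≥0∞, Measurable F → ∫⁻ y, ∑' k, F (φ k y) ∂ν = C * ∫⁻ x, F x ∂μ) (k : K) :
    Measure.QuasiMeasurePreserving (φ k) ν μ := by
  refine ⟨hφ k, Measure.AbsolutelyContinuous.mk fun s hs h0 => ?_⟩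
  rw [Measure.map_apply (hφ k) hs]
  have h := hC (s.indicator 1) (measurable_one.indicator hs)
  rw [lintegral_indicator_one hs, h0, mul_zero] at h
  rw [← nonpos_iff_eq_zero, ← h, ← lintegral_indicator_one (hφ k hs)]
  exact lintegral_mono fun y => ENNReal.le_tsum (f := fun k => s.indicator 1 (φ k y)) k

lemma memℓp_fiber_ae [Countable K] (hφ : ∀ k, Measurable (φ k)) (hCtop : C ≠ ∞)
    (hC : ∀ F : X → ℝ≥0∞, Measurable F → ∫⁻ y, ∑' k, F (φ k y) ∂ν = C * ∫⁻ x, F x ∂μ)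
    (a : ℂ) (g : Lp ℂ 2 μ) : ∀ᵐ y ∂ν, Memℓp (fun k => a * g (φ k y)) 2 := by
  have hg : Measurable fun x => ‖g x‖ₑ ^ 2 := (Lp.stronglyMeasurable g).measurable.enorm.pow_const 2
  have hfin : ∫⁻ y, ∑' k, ‖g (φ k y)‖ₑ ^ 2 ∂ν ≠ ∞ := by
    rw [hC _ hg]
    exact ENNReal.mul_ne_top hCtop (lintegral_enorm_sq_ne_top_of_memLp (Lp.memLp g))
  have hmeas : Measurable fun y => ∑' k, ‖g (φ k y)‖ₑ ^ 2 :=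
    Measurable.tsum fun k => hg.comp (hφ k)
  filter_upwards [ae_lt_top hmeas hfin] with y hy
  exact (memℓp_two_of_tsum_ne_top hy.ne).const_mul a

lemma lintegral_enorm_toLpTwo_fiber [Countable K] (hφ : ∀ k, Measurable (φ k)) (hCtop : C ≠ ∞)
    (hC : ∀ F : X → ℝ≥0∞, Measurable F → ∫⁻ y, ∑' k, F (φ k y) ∂ν = C * ∫⁻ x, F x ∂μ)
    {a : ℂ} (ha : ‖a‖ₑ ^ 2 * C = 1) (g : Lp ℂ 2 μ) :
    ∫⁻ y, ‖toLpTwo fun k => a * g (φ k y)‖ₑ ^ 2 ∂ν = ∫⁻ x, ‖g x‖ₑ ^ 2 ∂μ := by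
  have hg : Measurable fun x => ‖g x‖ₑ ^ 2 := (Lp.stronglyMeasurable g).measurable.enorm.pow_const 2
  have hmeas : Measurable fun y => ∑' k, ‖g (φ k y)‖ₑ ^ 2 :=
    Measurable.tsum fun k => hg.comp (hφ k)
  calc ∫⁻ y, ‖toLpTwo fun k => a * g (φ k y)‖ₑ ^ 2 ∂ν
      = ∫⁻ y, ‖a‖ₑ ^ 2 * ∑' k, ‖g (φ k y)‖ₑ ^ 2 ∂ν := by
        refine lintegral_congr_ae ?_
        filter_upwards [memℓp_fiber_ae hφ hCtop hC a g] with y hy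
        simp only [lp_two_enorm_sq, toLpTwo_apply hy, enorm_mul, mul_pow, ENNReal.tsum_mul_left]
    _ = ∫⁻ x, ‖g x‖ₑ ^ 2 ∂μ := by
        rw [lintegral_const_mul _ hmeas, hC _ hg, ← mul_assoc, ha, one_mul]

/-- If the maps `φ k` send `ν` to pieces of `C • μ` that add up to `C • μ` and have a common
measurable inverse `x ↦ (ψ x, κ x)`, then `g ↦ (y ↦ (a * g (φ k y))_k)` is unitary from `L²(μ)` onto
`L²(ν, ℓ²)` as soon as `|a|² C = 1`. -/
lemma exists_fiber_unitary [Countable K] [MeasurableSpace K] [MeasurableSingletonClass K]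
    (hφ : ∀ k, Measurable (φ k)) (hCtop : C ≠ ∞)
    (hC : ∀ F : X → ℝ≥0∞, Measurable F → ∫⁻ y, ∑' k, F (φ k y) ∂ν = C * ∫⁻ x, F x ∂μ)
    {a : ℂ} (ha : ‖a‖ₑ ^ 2 * C = 1)
    {κ : X → K} {ψ : X → Y} (hκ : Measurable κ) (hψ : Measurable ψ)
    (hψφ : ∀ᵐ y ∂ν, ∀ k, κ (φ k y) = k ∧ ψ (φ k y) = y) :
    ∃ T : Lp ℂ 2 μ ≃ₗᵢ[ℂ] Lp (lp (fun _ : K => ℂ) 2) 2 ν,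
      ∀ g : Lp ℂ 2 μ, ∀ᵐ y ∂ν, ∀ k, T g y k = a * g (φ k y) := by
  have hqmp := quasiMeasurePreserving_of_lintegral_tsum hφ hC
  have hmemℓ := memℓp_fiber_ae hφ hCtop hC a
  have hmem (g : Lp ℂ 2 μ) : MemLp (fun y => toLpTwo fun k => a * g (φ k y)) 2 ν := by
    refine memLp_two_of_lintegral_ne_top (aestronglyMeasurable_toLpTwo (fun k => ?_) (hmemℓ g)) ?_
    · exact (((Lp.stronglyMeasurable g).comp_measurable (hφ k)).const_mul a).aestronglyMeasurable
    · rw [lintegral_enorm_toLpTwo_fiber hφ hCtop hC ha]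
      exact lintegral_enorm_sq_ne_top_of_memLp (Lp.memLp g)
  have hcoe (g : Lp ℂ 2 μ) : ∀ᵐ y ∂ν, ∀ k, (hmem g).toLp _ y k = a * g (φ k y) := by
    filter_upwards [(hmem g).coeFn_toLp, hmemℓ g] with y hy hy' k
    rw [hy, toLpTwo_apply hy']
  let T : Lp ℂ 2 μ →ₗᵢ[ℂ] Lp (lp (fun _ : K => ℂ) 2) 2 ν :=
    { toFun := fun g => (hmem g).toLp _
      map_add' := fun g h => by
        refine Lp.ext ?_
        filter_upwards [hcoe (g + h), hcoe g, hcoe h, Lp.coeFn_add ((hmem g).toLp _)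
          ((hmem h).toLp _), ae_all_iff.2 fun k => (hqmp k).ae (Lp.coeFn_add g h)]
          with y h1 h2 h3 h4 h5
        ext k
        rw [h1 k, h5 k, h4]
        simp only [Pi.add_apply, lp.coeFn_add, h2, h3, mul_add]
      map_smul' := fun c g => by
        refine Lp.ext ?_
        filter_upwards [hcoe (c • g), hcoe g, Lp.coeFn_smul c ((hmem g).toLp _),
          ae_all_iff.2 fun k => (hqmp k).ae (Lp.coeFn_smul c g)] with y h1 h2 h3 h4
        ext k
        simp [h1, h2, h3, h4, mul_left_comm]
      norm_map' := fun g => by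
        refine norm_Lp_two_eq_of_lintegral_eq _ _ ?_
        rw [← lintegral_enorm_toLpTwo_fiber hφ hCtop hC ha g]
        refine lintegral_congr_ae ?_
        filter_upwards [(hmem g).coeFn_toLp] with y hy
        exact congrArg (‖·‖ₑ ^ 2) hy }
  have ha0 : a ≠ 0 := by
    rintro rfl
    simp at ha
  have hC0 : C ≠ 0 := by
    rintro rfl
    simp at ha
  have hsurj : Function.Surjective T := by
    intro G
    have hGk (k : K) : Measurable fun y => G y k :=
      ((lp.evalCLM ℂ (fun _ : K => ℂ) 2 k).continuous.comp_stronglyMeasurable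
        (Lp.stronglyMeasurable G)).measurable
    have hG : Measurable fun p : Y × K => G p.1 p.2 := measurable_from_prod_countable_left hGk
    have hg : Measurable fun x => a⁻¹ * G (ψ x) (κ x) :=
      (hG.comp (hψ.prodMk hκ)).const_mul _
    have hgmem : MemLp (fun x => a⁻¹ * G (ψ x) (κ x)) 2 μ := by
      refine memLp_two_of_lintegral_ne_top hg.aestronglyMeasurable fun htop => ?_
      have h := hC _ (hg.enorm.pow_const 2)
      rw [htop, ENNReal.mul_top hC0] at h
      have h' : ∫⁻ y, ∑' k, ‖a⁻¹ * G (ψ (φ k y)) (κ (φ k y))‖ₑ ^ 2 ∂ν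
          = ‖a⁻¹‖ₑ ^ 2 * ∫⁻ y, ‖G y‖ₑ ^ 2 ∂ν := by
        rw [← lintegral_const_mul _ ((Lp.stronglyMeasurable G).enorm.pow_const 2)]
        refine lintegral_congr_ae ?_
        filter_upwards [hψφ] with y hy
        simp only [hy, lp_two_enorm_sq, enorm_mul, mul_pow, ENNReal.tsum_mul_left]
      rw [h'] at h
      exact ENNReal.mul_ne_top (ENNReal.pow_ne_top enorm_ne_top)
        (lintegral_enorm_sq_ne_top_of_memLp (Lp.memLp G)) h
    refine ⟨hgmem.toLp _, Lp.ext ?_⟩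
    filter_upwards [hcoe (hgmem.toLp _), hψφ, ae_all_iff.2 fun k => (hqmp k).ae hgmem.coeFn_toLp]
      with y h1 h2 h3
    ext k
    refine (h1 k).trans ?_
    rw [h3 k, (h2 k).1, (h2 k).2, mul_inv_cancel_left₀ ha0]
  exact ⟨LinearIsometryEquiv.ofSurjective T hsurj, hcoe⟩

end Fibering

section Chirp

lemma chirp_neg_chirp (θ : ℝ) (f : Rn n → ℂ) (t : Rn n) :
    Complex.exp (((Real.pi * ⟪t, t⟫_ℝ * Real.cot θ : ℝ) : ℂ) * Complex.I) *
      chirp (-θ) f t = f t := by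
  have hcot : Real.cot (-θ) = -Real.cot θ := by
    simp [Real.cot_eq_cos_div_sin, div_neg]
  rw [chirp, hcot, ← mul_assoc, ← Complex.exp_add]
  simp

lemma coeFn_chirpLp (θ : ℝ) (f : Lp ℂ 2 (volume : Measure (Rn n))) :
    chirpLp θ f =ᵐ[volume] chirp θ f :=
  MemLp.coeFn_toLp _

lemma chirpLp_chirpLp_neg (θ : ℝ) (f : Lp ℂ 2 (volume : Measure (Rn n))) :
    chirpLp θ (chirpLp (-θ) f) = f := by
  refine Lp.ext ?_
  filter_upwards [coeFn_chirpLp θ (chirpLp (-θ) f), coeFn_chirpLp (-θ) f] with t h1 h2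
  rw [h1, chirp, h2, chirp_neg_chirp]

/-- Chirp modulation as a unitary operator on `L²(ℝⁿ)`. -/
def chirpIsometryEquiv (n : ℕ) (θ : ℝ) :
    Lp ℂ 2 (volume : Measure (Rn n)) ≃ₗᵢ[ℂ] Lp ℂ 2 (volume : Measure (Rn n)) :=
  LinearIsometryEquiv.ofSurjective
    { toFun := chirpLp θ
      map_add' := fun f g => by
        refine Lp.ext ?_
        filter_upwards [coeFn_chirpLp θ (f + g), coeFn_chirpLp θ f, coeFn_chirpLp θ g,
          Lp.coeFn_add f g, Lp.coeFn_add (chirpLp θ f) (chirpLp θ g)] with t h1 h2 h3 h4 h5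
        rw [h1, h5, Pi.add_apply, h2, h3, chirp, h4, Pi.add_apply, mul_add, chirp, chirp]
      map_smul' := fun c f => by
        refine Lp.ext ?_
        filter_upwards [coeFn_chirpLp θ (c • f), coeFn_chirpLp θ f, Lp.coeFn_smul c f,
          Lp.coeFn_smul c (chirpLp θ f)] with t h1 h2 h3 h4
        simp only [RingHom.id_apply]
        rw [h1, h4, Pi.smul_apply, h2, chirp, h3, Pi.smul_apply, chirp, smul_eq_mul, smul_eq_mul,
          mul_left_comm]
      norm_map' := fun f => by
        refine norm_Lp_two_eq_of_lintegral_eq _ _ (lintegral_congr_ae ?_)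
        filter_upwards [coeFn_chirpLp θ f] with t ht
        change ‖chirpLp θ f t‖ₑ ^ 2 = ‖f t‖ₑ ^ 2
        rw [ht, chirp, enorm_mul, ← ofReal_norm, Complex.norm_exp_ofReal_mul_I, ENNReal.ofReal_one,
          one_mul] }
    fun f => ⟨chirpLp (-θ) f, chirpLp_chirpLp_neg θ f⟩

lemma chirpIsometryEquiv_apply (θ : ℝ) (f : Lp ℂ 2 (volume : Measure (Rn n))) :
    chirpIsometryEquiv n θ f = chirpLp θ f := rfl

end Chirp

section Tiling

lemma lintegral_comp_const_smul {c : ℝ} (hc : c ≠ 0) {F : Rn n → ℝ≥0∞}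
    (hF : Measurable F) :
    ∫⁻ ω, F (c • ω) = ENNReal.ofReal (|c|⁻¹ ^ n) * ∫⁻ x, F x := by
  rw [← lintegral_map hF (measurable_const_smul c), Measure.map_addHaar_smul _ hc,
    lintegral_smul_measure, smul_eq_mul, finrank_euclideanSpace_fin, abs_inv, abs_pow, inv_pow]

/-- There is an integer part suited to the orientation of the interval `s⁻¹ • [0, |s|)`. -/
lemma exists_integer_part {s : ℝ} (hs : s ≠ 0) : ∃ κ : ℝ → ℤ, Measurable κ ∧
    (∀ x (k : ℤ), κ (x + k) = κ x + k) ∧ ∀ w, κ (s⁻¹ * w) = 0 ↔ w ∈ Set.Ico 0 |s| := by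
  rcases lt_or_gt_of_ne hs with h | h
  · refine ⟨fun x => ⌈x⌉, Int.measurable_ceil, fun x k => Int.ceil_add_intCast x k, fun w => ?_⟩
    rw [Int.ceil_eq_zero_iff, abs_of_neg h, Set.mem_Ioc, Set.mem_Ico, ← div_eq_inv_mul,
      lt_div_iff_of_neg h, div_nonpos_iff]
    constructor
    · rintro ⟨h1, h2 | h2⟩ <;> constructor <;> linarith
    · rintro ⟨h1, h2⟩
      exact ⟨by linarith, Or.inl ⟨h1, h.le⟩⟩
  · refine ⟨fun x => ⌊x⌋, Int.measurable_floor, fun x k => Int.floor_add_intCast x k, fun w => ?_⟩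
    rw [Int.floor_eq_zero_iff, abs_of_pos h, Set.mem_Ico, Set.mem_Ico, ← div_eq_inv_mul,
      div_lt_one h, le_div_iff₀ h, zero_mul]

lemma zcast_apply (k : Fin n → ℤ) (i : Fin n) : zcast k i = (k i : ℝ) := rfl

lemma halfOpen_ae_eq_Iθ (n : ℕ) (θ : ℝ) :
    {ω : Rn n | ∀ i, ω i ∈ Set.Ico (0 : ℝ) |Real.sin θ|} =ᵐ[volume] Iθ n θ := by
  have h := (PiLp.volume_preserving_ofLp (Fin n)).quasiMeasurePreserving.preimage_ae_eq
    (Measure.univ_pi_Ico_ae_eq_Icc (μ := fun _ : Fin n => (volume : Measure ℝ))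
      (f := fun _ => 0) (g := fun _ => |Real.sin θ|))
  have hIco : {ω : Rn n | ∀ i, ω i ∈ Set.Ico (0 : ℝ) |Real.sin θ|} =
      WithLp.ofLp ⁻¹' Set.univ.pi fun _ => Set.Ico 0 |Real.sin θ| := by
    ext ω
    simp
  have hIcc : Iθ n θ = WithLp.ofLp ⁻¹' Set.Icc (fun _ => 0) fun _ => |Real.sin θ| := by
    ext ω
    simp [Iθ, Pi.le_def, forall_and]
  rw [hIco, hIcc]
  exact h

/-- Periodization of an integral over the integer translates of a half-open fundamental box. -/
lemma lintegral_tsum_of_tiling {c : ℝ} (hc : c ≠ 0) {κ : Rn n → Fin n → ℤ} (hκ : Measurable κ)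
    (hadd : ∀ x k, κ (x + zcast k) = κ x + k) {F : Rn n → ℝ≥0∞} (hF : Measurable F) :
    ∫⁻ ω in {ω | κ (c • ω) = 0}, ∑' k, F (c • ω + zcast k) =
      ENNReal.ofReal (|c|⁻¹ ^ n) * ∫⁻ x, F x := by
  have hpiece (k : Fin n → ℤ) : MeasurableSet {x | κ x = k} := hκ (measurableSet_singleton k)
  have hbox : MeasurableSet {ω | κ (c • ω) = 0} := measurable_const_smul c (hpiece 0)
  have hFk (k : Fin n → ℤ) : Measurable fun x => F (x + zcast k) :=
    hF.comp (measurable_add_const _)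
  have hpart : ∫⁻ x, F x = ∑' k, ∫⁻ x in {x | κ x = k}, F x := by
    rw [← lintegral_iUnion hpiece]
    · rw [← setLIntegral_univ]
      congr 2
      ext x
      simp
    · intro k l hkl
      exact Set.disjoint_left.2 fun x hk hl => hkl (hk.symm.trans hl)
  have hterm (k : Fin n → ℤ) : ∫⁻ ω in {ω | κ (c • ω) = 0}, F (c • ω + zcast k) =
      ENNReal.ofReal (|c|⁻¹ ^ n) * ∫⁻ x in {x | κ x = k}, F x := by
    rw [← lintegral_indicator hbox, ← lintegral_indicator (hpiece k),
      ← lintegral_add_right_eq_self ({x | κ x = k}.indicator F) (zcast k)]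
    refine (lintegral_comp_const_smul hc ((hFk k).indicator (hpiece 0))).trans ?_
    refine congrArg (ENNReal.ofReal (|c|⁻¹ ^ n) * ·) (lintegral_congr fun x => ?_)
    simp [Set.indicator, hadd]
  have hmeas (k : Fin n → ℤ) : Measurable fun ω => F (c • ω + zcast k) :=
    (hFk k).comp (measurable_const_smul c)
  rw [lintegral_tsum fun k => (hmeas k).aemeasurable, hpart, ← ENNReal.tsum_mul_left]
  exact tsum_congr hterm

end Tiling

/-- The fiber map `τ^θ` is a well-defined unitary operator from `L²(ℝⁿ)`
onto `L²(I, ℓ²(ℤⁿ))`; in particular `‖f‖² = |sin θ|^{-n} ∫_I Σ_k |(C_θ f)^(ω csc θ + k)|² dω`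
for every `f ∈ L²(ℝⁿ)`. -/
theorem statement9 (n : ℕ) (hn : 1 ≤ n) (θ : ℝ) (hθ : Real.sin θ ≠ 0)
    (𝓕 : Lp ℂ 2 (volume : Measure (Rn n)) ≃ₗᵢ[ℂ] Lp ℂ 2 (volume : Measure (Rn n)))
    (h𝓕 : IsPlancherel 𝓕) :
    (∃ τ : Lp ℂ 2 (volume : Measure (Rn n)) ≃ₗᵢ[ℂ]
        Lp (lp (fun _ : Fin n → ℤ => ℂ) 2) 2 ((volume : Measure (Rn n)).restrict (Iθ n θ)),
      ∀ f : Lp ℂ 2 (volume : Measure (Rn n)),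
        ∀ᵐ ω ∂((volume : Measure (Rn n)).restrict (Iθ n θ)), ∀ k : Fin n → ℤ,
          ((τ f : Rn n → lp (fun _ : Fin n → ℤ => ℂ) 2) ω) k = fiber 𝓕 θ f ω k) ∧
    ∀ f : Lp ℂ 2 (volume : Measure (Rn n)),
      (∫⁻ t, (‖(f : Rn n → ℂ) t‖₊ : ℝ≥0∞) ^ 2) =
        ENNReal.ofReal (|Real.sin θ| ^ (-(n : ℝ))) *
          ∫⁻ ω in Iθ n θ, ∑' k : Fin n → ℤ,
            (‖(𝓕 (chirpLp θ f) : Rn n → ℂ) ((Real.sin θ)⁻¹ • ω + zcast k)‖₊ : ℝ≥0∞) ^ 2 := by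
  set s := Real.sin θ
  obtain ⟨κ₁, hκ₁, hadd₁, hbox₁⟩ := exists_integer_part hθ
  let κ : Rn n → Fin n → ℤ := fun x i => κ₁ (x i)
  let ψ : Rn n → Rn n := fun x => s • (x - zcast (κ x))
  let φ : (Fin n → ℤ) → Rn n → Rn n := fun k ω => s⁻¹ • ω + zcast k
  have hκ : Measurable κ :=
    measurable_pi_lambda _ fun i => hκ₁.comp (by fun_prop)
  have hzcast : Measurable (zcast (n := n)) := measurable_of_countable _
  have hψ : Measurable ψ := (measurable_id.sub (hzcast.comp hκ)).const_smul s
  have hφ (k : Fin n → ℤ) : Measurable (φ k) := (measurable_const_smul s⁻¹).add_const _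
  have hadd (x : Rn n) (k : Fin n → ℤ) : κ (x + zcast k) = κ x + k := by
    ext i
    simp [κ, zcast_apply, hadd₁]
  have hboxeq : {ω : Rn n | κ (s⁻¹ • ω) = 0} = {ω | ∀ i, ω i ∈ Set.Ico (0 : ℝ) |s|} := by
    ext ω
    simp only [Set.mem_ofPred_eq, funext_iff, κ, PiLp.smul_apply, smul_eq_mul, Pi.zero_apply, hbox₁]
  have hbox : {ω : Rn n | κ (s⁻¹ • ω) = 0} =ᵐ[volume] Iθ n θ :=
    hboxeq ▸ halfOpen_ae_eq_Iθ n θ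
  have hs : 0 < |s| := abs_pos.2 hθ
  have hC (F : Rn n → ℝ≥0∞) (hF : Measurable F) :
      ∫⁻ ω in Iθ n θ, ∑' k, F (φ k ω) = ENNReal.ofReal (|s| ^ n) * ∫⁻ x, F x := by
    have := lintegral_tsum_of_tiling (inv_ne_zero hθ) hκ hadd hF
    rwa [abs_inv, inv_inv, setLIntegral_congr hbox] at this
  have hψφ : ∀ᵐ ω ∂(volume : Measure (Rn n)).restrict (Iθ n θ),
      ∀ k, κ (φ k ω) = k ∧ ψ (φ k ω) = ω := by
    rw [← Measure.restrict_congr_set hbox]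
    filter_upwards [ae_restrict_mem ((hκ.comp (measurable_const_smul s⁻¹))
      (measurableSet_singleton 0))] with ω hω k
    have hk : κ (φ k ω) = k := by
      rw [hadd, show κ (s⁻¹ • ω) = 0 from hω, zero_add]
    refine ⟨hk, ?_⟩
    simp only [ψ, hk]
    simp [φ, smul_smul, hθ]
  constructor
  · have ha : ‖((|s| ^ (-(n : ℝ) / 2) : ℝ) : ℂ)‖ₑ ^ 2 * ENNReal.ofReal (|s| ^ n) = 1 := by
      rw [← ofReal_norm, Complex.norm_real, Real.norm_of_nonneg (by positivity),
        ← ENNReal.ofReal_pow (by positivity), ← ENNReal.ofReal_mul (by positivity),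
        ← Real.rpow_natCast, ← Real.rpow_natCast, ← Real.rpow_mul hs.le, ← Real.rpow_add hs]
      simp
    obtain ⟨T, hT⟩ := exists_fiber_unitary hφ ENNReal.ofReal_ne_top hC ha hκ hψ hψφ
    exact ⟨((chirpIsometryEquiv n θ).trans 𝓕).trans T, fun f => hT (𝓕 (chirpLp θ f))⟩
  · intro f
    have hnorm : eLpNorm f 2 volume = eLpNorm (𝓕 (chirpLp θ f)) 2 volume := by
      have h : ‖f‖ = ‖𝓕 (chirpLp θ f)‖ := by
        rw [𝓕.norm_map, ← chirpIsometryEquiv_apply, LinearIsometryEquiv.norm_map]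
      rwa [Lp.norm_def, Lp.norm_def, ENNReal.toReal_eq_toReal_iff' (Lp.eLpNorm_ne_top _)
        (Lp.eLpNorm_ne_top _)] at h
    have hFf := hC (fun x => ‖𝓕 (chirpLp θ f) x‖ₑ ^ 2)
      ((Lp.stronglyMeasurable _).measurable.enorm.pow_const 2)
    rw [← eLpNorm_two_sq_eq_lintegral, ← hnorm, eLpNorm_two_sq_eq_lintegral] at hFf
    refine Eq.trans ?_ (congrArg (ENNReal.ofReal (|s| ^ (-(n : ℝ))) * ·) hFf).symm
    rw [← mul_assoc, ← ENNReal.ofReal_mul (by positivity), Real.rpow_neg hs.le, Real.rpow_natCast,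
      inv_mul_cancel₀ (by positivity), ENNReal.ofReal_one, one_mul]
    rfl
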